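/- arXiv:1807.10763 — 2 statements merged into one kernel-verified Lean document; each statement's English description precedes it below -/
import Mathlib

section
/- For all parameters α, λ, θ, b > 0, if either (α > 1 and αθ > 1) or (α = 1 and θ > 1), then the GPGW hazard rate function h(t) = αλθb · t^(α-1) · (1 + λt^α)^(θ-1) is strictly monotone increasing on (0, ∞). -/
open Real Set

lemma rpow_mul_one_add_rpow_eq {a lam th t : ℝ} (hlam : 0 < lam) (ht : 0 < t) :
    t ^ (a - 1) * (1 + lam * t ^ a) ^ (th - 1) =
      t ^ (a * th - 1) * (t ^ (-a) + lam) ^ (th - 1) := by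
  have hfactor : 1 + lam * t ^ a = t ^ a * (t ^ (-a) + lam) := by
    rw [mul_add, ← rpow_add ht, add_neg_cancel, rpow_zero, mul_comm lam]
  rw [hfactor, mul_rpow (by positivity) (by positivity), ← rpow_mul ht.le, ← mul_assoc,
    ← rpow_add ht]
  ring_nf

lemma strictMonoOn_rpow_mul_one_add_rpow {a lam th : ℝ} (ha : 0 < a) (hlam : 0 < lam)
    (h : (1 < a ∧ 1 < a * th) ∨ (a = 1 ∧ 1 < th)) :
    StrictMonoOn (fun t : ℝ => t ^ (a - 1) * (1 + lam * t ^ a) ^ (th - 1)) (Ioi 0) := by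
  intro x (hx : 0 < x) y (hy : 0 < y) hxy
  have hbase : 1 + lam * x ^ a < 1 + lam * y ^ a := by
    have := rpow_lt_rpow hx.le hxy ha
    gcongr
  rcases h with ⟨ha1, hath⟩ | ⟨rfl, hth1⟩
  · rcases le_or_gt 1 th with hth1 | hth1
    · exact mul_lt_mul (rpow_lt_rpow hx.le hxy (by linarith))
        (rpow_le_rpow (by positivity) hbase.le (by linarith)) (by positivity) (by positivity)
    · simp only [rpow_mul_one_add_rpow_eq hlam hx, rpow_mul_one_add_rpow_eq hlam hy]
      have hneg : y ^ (-a) < x ^ (-a) := rpow_lt_rpow_of_neg hx hxy (by linarith)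
      exact mul_lt_mul (rpow_lt_rpow hx.le hxy (by linarith))
        (rpow_le_rpow_of_nonpos (by positivity) (by linarith) (by linarith))
        (by positivity) (by positivity)
  · simpa using rpow_lt_rpow (by positivity) hbase (sub_pos.2 hth1)

theorem gpgw_hazard_increasing (a lam th b : ℝ) (ha : 0 < a) (hlam : 0 < lam)
    (hth : 0 < th) (hb : 0 < b)
    (h : (1 < a ∧ 1 < a * th) ∨ (a = 1 ∧ 1 < th)) :
    StrictMonoOn (fun t : ℝ => a * lam * th * b * t ^ (a - 1) * (1 + lam * t ^ a) ^ (th - 1))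
      (Set.Ioi 0) := by
  intro x hx y hy hxy
  simp only [mul_assoc (a * lam * th * b)]
  exact mul_lt_mul_of_pos_left (strictMonoOn_rpow_mul_one_add_rpow ha hlam h hx hy hxy)
    (by positivity)
end

section
/- For all parameters α, λ, θ, b > 0 with 0 < α < 1 and αθ > 1, the GPGW hazard rate function h(t) = αλθb · t^(α-1) · (1 + λt^α)^(θ-1) is bathtub shaped: setting t* = ((1-α)/(λ(αθ-1)))^(1/α), h is strictly decreasing on (0, t*] and strictly increasing on [t*, ∞). -/
open Real Set

theorem hasDerivAt_gpgw_hazard {a lam th b t : ℝ} (hlam : 0 < lam) (ht : 0 < t) :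
    HasDerivAt
      (fun t : ℝ => a * lam * th * b * t ^ (a - 1) * (1 + lam * t ^ a) ^ (th - 1))
      (a * lam * th * b * t ^ (a - 2) * (1 + lam * t ^ a) ^ (th - 2) *
        (lam * (a * th - 1) * t ^ a - (1 - a))) t := by
  have hbase : 0 < 1 + lam * t ^ a := by positivity
  have hpow : HasDerivAt (fun t : ℝ => t ^ (a - 1)) ((a - 1) * t ^ (a - 1 - 1)) t :=
    hasDerivAt_rpow_const (Or.inl ht.ne')
  have hinner : HasDerivAt (fun t : ℝ => 1 + lam * t ^ a) (lam * (a * t ^ (a - 1))) t :=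
    ((hasDerivAt_rpow_const (Or.inl ht.ne')).const_mul lam).const_add 1
  have houter := hinner.rpow_const (p := th - 1) (Or.inl hbase.ne')
  refine ((hpow.const_mul (a * lam * th * b)).mul houter).congr_deriv ?_
  have h₁ : t ^ (a - 1) = t ^ (a - 2) * t := by
    rw [← rpow_add_one ht.ne']; ring_nf
  have h₂ : t ^ a = t ^ (a - 2) * t * t := by
    rw [← h₁, ← rpow_add_one ht.ne']; ring_nf
  have h₃ : (1 + lam * t ^ a) ^ (th - 1) =
      (1 + lam * t ^ a) ^ (th - 2) * (1 + lam * t ^ a) := by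
    rw [← rpow_add_one hbase.ne']; ring_nf
  have h₄ : a - 1 - 1 = a - 2 := by ring
  have h₅ : th - 1 - 1 = th - 2 := by ring
  rw [h₄, h₅, h₃, h₁]
  generalize (1 + lam * t ^ a) ^ (th - 2) = y
  rw [h₂]
  ring

theorem gpgw_hazard_bathtub (a lam th b : ℝ) (ha0 : 0 < a) (hlam : 0 < lam)
    (hth : 0 < th) (hb : 0 < b) (ha1 : a < 1) (hath : 1 < a * th) :
    StrictAntiOn (fun t : ℝ => a * lam * th * b * t ^ (a - 1) * (1 + lam * t ^ a) ^ (th - 1))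
      (Set.Ioc 0 (((1 - a) / (lam * (a * th - 1))) ^ (1 / a))) ∧
    StrictMonoOn (fun t : ℝ => a * lam * th * b * t ^ (a - 1) * (1 + lam * t ^ a) ^ (th - 1))
      (Set.Ici (((1 - a) / (lam * (a * th - 1))) ^ (1 / a))) := by
  have hden : 0 < lam * (a * th - 1) := mul_pos hlam (sub_pos.2 hath)
  have hratio : 0 < (1 - a) / (lam * (a * th - 1)) := div_pos (sub_pos.2 ha1) hden
  set s := ((1 - a) / (lam * (a * th - 1))) ^ (1 / a) with hs
  have hs_pos : 0 < s := rpow_pos_of_pos hratio _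
  have hs_pow : s ^ a = (1 - a) / (lam * (a * th - 1)) := by
    rw [hs, ← rpow_mul hratio.le, one_div_mul_cancel ha0.ne', rpow_one]
  constructor
  · refine strictAntiOn_of_deriv_neg (convex_Ioc 0 s)
      (fun t ht => (hasDerivAt_gpgw_hazard hlam ht.1).continuousAt.continuousWithinAt) ?_
    intro t ht
    rw [interior_Ioc] at ht
    have ht0 : 0 < t := ht.1
    rw [(hasDerivAt_gpgw_hazard hlam ht0).deriv]
    have hlt : t ^ a < s ^ a := rpow_lt_rpow ht0.le ht.2 ha0
    rw [hs_pow, lt_div_iff₀ hden] at hlt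
    exact mul_neg_of_pos_of_neg (by positivity) (by linarith)
  · refine strictMonoOn_of_deriv_pos (convex_Ici s)
      (fun t ht => (hasDerivAt_gpgw_hazard hlam
        (hs_pos.trans_le ht)).continuousAt.continuousWithinAt) ?_
    intro t ht
    rw [interior_Ici] at ht
    have ht0 : 0 < t := hs_pos.trans ht
    rw [(hasDerivAt_gpgw_hazard hlam ht0).deriv]
    have hlt : s ^ a < t ^ a := rpow_lt_rpow hs_pos.le ht ha0
    rw [hs_pow, div_lt_iff₀ hden] at hlt
    exact mul_pos (by positivity) (by linarith)
end
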